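/- For every m ∈ ℕ ∪ {0}, each s ∈ {2,3,4}, and each p ∈ {0,1,…,s−1}, the Hermite function h_{4m+3} satisfies ∑_{k∈ℤ} h_{4m+3}(√s·(k + p/s)) = 0. -/

import Mathlib

open MeasureTheory Complex Real FourierTransform

/-- The Zak transform `Z_λ f (x, γ) = √λ ∑_{k∈ℤ} f(λ(x+k)) e^{-2πikγ}`. -/
noncomputable def zak (lam : ℝ) (f : ℝ → ℂ) (x γ : ℝ) : ℂ :=
  (Real.sqrt lam : ℂ) *
    ∑' k : ℤ, f (lam * (x + k)) * Complex.exp (-2 * Real.pi * Complex.I * k * γ)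

/-- Membership in the Wiener space `W(ℝ)`:
`∑_{k∈ℤ} sup_{x∈[0,1]} |f(x+k)| < ∞`. -/
def InWiener (f : ℝ → ℂ) : Prop :=
  Summable (fun k : ℤ => ⨆ x : Set.Icc (0:ℝ) 1, ‖f ((x : ℝ) + k)‖)

/-- The `n`-th Hermite function `h_n(x) = c_n^{-1/2} e^{π x²} (d/dx)^n e^{-2π x²}`
with `c_n = (2π)^n 2^{n-1/2} n!`. -/
noncomputable def hermiteFun (n : ℕ) (x : ℝ) : ℝ :=
  ((2 * Real.pi) ^ n * (2:ℝ) ^ ((n : ℝ) - 1/2) * (n.factorial : ℝ)) ^ (-(1/2 : ℝ)) *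
    Real.exp (Real.pi * x ^ 2) * iteratedDeriv n (fun t => Real.exp (-2 * Real.pi * t ^ 2)) x

open Polynomial Filter Asymptotics

/-- A real polynomial times the Gaussian `e^{-πx²}`, as a complex-valued function. -/
noncomputable def polyGauss (P : ℝ[X]) (x : ℝ) : ℂ :=
  ((P.eval x * Real.exp (-Real.pi * x ^ 2) : ℝ) : ℂ)

lemma hasDerivAt_polyGauss (P : ℝ[X]) (x : ℝ) :
    HasDerivAt (polyGauss P) (polyGauss (derivative P - C (2 * Real.pi) * X * P) x) x := by
  have h : HasDerivAt (fun y : ℝ => P.eval y * Real.exp (-Real.pi * y ^ 2)) _ x :=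
    (P.hasDerivAt x).mul (((hasDerivAt_pow 2 x).const_mul (-Real.pi)).exp)
  refine h.ofReal_comp.congr_deriv ?_
  simp only [polyGauss, eval_sub, eval_mul, eval_C, eval_X]
  congr 1
  push_cast
  ring

lemma continuous_polyGauss (P : ℝ[X]) : Continuous (polyGauss P) :=
  continuous_iff_continuousAt.2 fun x => (hasDerivAt_polyGauss P x).continuousAt

lemma polyGauss_add (P Q : ℝ[X]) : polyGauss (P + Q) = polyGauss P + polyGauss Q := by
  ext x
  simp [polyGauss, add_mul]

lemma polyGauss_monomial (n : ℕ) (a x : ℝ) :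
    polyGauss (monomial n a) x = ((a * (x ^ n * Real.exp (-Real.pi * x ^ 2)) : ℝ) : ℂ) := by
  simp [polyGauss, mul_assoc]

lemma integrable_polyGauss (P : ℝ[X]) : Integrable (polyGauss P) := by
  induction P using Polynomial.induction_on' with
  | add P Q hP hQ => rw [polyGauss_add]; exact hP.add hQ
  | monomial n a =>
    have h := integrable_rpow_mul_exp_neg_mul_sq Real.pi_pos (s := n)
      (by linarith [n.cast_nonneg (α := ℝ)])
    simp_rw [Real.rpow_natCast] at h
    exact (h.const_mul a).ofReal.congr (ae_of_all _ fun x => (polyGauss_monomial n a x).symm)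

lemma polyGauss_isBigO (P : ℝ[X]) (b : ℝ) :
    polyGauss P =O[cocompact ℝ] fun x : ℝ => |x| ^ b := by
  induction P using Polynomial.induction_on' with
  | add P Q hP hQ => rw [polyGauss_add]; exact hP.add hQ
  | monomial n a =>
    have h := (isLittleO_exp_neg_mul_sq_cocompact (a := Real.pi) (by simpa using Real.pi_pos)
      (b - n)).isBigO
    have h1 : (fun x : ℝ => (a : ℂ) * (x : ℂ) ^ n) =O[cocompact ℝ] fun x : ℝ => |x| ^ n :=
      IsBigO.of_bound |a| (Eventually.of_forall fun x => by simp)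
    refine ((h1.mul h).congr' (Eventually.of_forall fun x => ?_) ?_)
    · rw [polyGauss_monomial]
      push_cast
      ring
    · have h0 : ∀ᶠ x : ℝ in cocompact ℝ, x ≠ 0 :=
        (isCompact_singleton (x := (0 : ℝ))).compl_mem_cocompact
      filter_upwards [h0] with x hx
      rw [← Real.rpow_natCast, ← Real.rpow_add (abs_pos.2 hx)]
      congr 1
      ring

lemma fourier_const_mul (c : ℂ) (f : ℝ → ℂ) (w : ℝ) :
    𝓕 (fun x => c * f x) w = c * 𝓕 f w :=
  congrFun (VectorFourier.fourierIntegral_const_smul Real.fourierChar volume (innerₗ ℝ) f c) w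

lemma fourier_polyGauss_one : 𝓕 (polyGauss 1) = polyGauss 1 := by
  have h := fourier_gaussian_pi (b := 1) (by simp)
  have h1 : polyGauss 1 = fun x : ℝ => Complex.exp (-Real.pi * 1 * x ^ 2) := by
    ext x
    simp [polyGauss]
  rw [h1, h]
  simp

lemma fourier_polyGauss_step {P : ℝ[X]} {c : ℂ}
    (h : ∀ x, 𝓕 (polyGauss P) x = c * polyGauss P x) (x : ℝ) :
    𝓕 (polyGauss (derivative P - C (4 * Real.pi) * X * P)) x =
      -I * c * polyGauss (derivative P - C (4 * Real.pi) * X * P) x := by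
  have hX : ∀ y : ℝ, (y : ℂ) * polyGauss P y = polyGauss (X * P) y := fun y => by
    simp [polyGauss, mul_assoc]
  have hd : deriv (polyGauss P) = polyGauss (derivative P - C (2 * Real.pi) * X * P) :=
    funext fun y => (hasDerivAt_polyGauss P y).deriv
  have hsplit : ∀ y, polyGauss (derivative P - C (4 * Real.pi) * X * P) y =
      deriv (polyGauss P) y - 2 * Real.pi * y * polyGauss P y := fun y => by
    rw [hd]
    simp only [polyGauss, eval_sub, eval_mul, eval_C, eval_X]
    push_cast
    ring
  have hsplit' : polyGauss (derivative P - C (4 * Real.pi) * X * P) =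
      deriv (polyGauss P) + (-I) • fun y : ℝ => (-2 * Real.pi * I * y) • polyGauss P y := by
    ext y
    rw [hsplit]
    simp only [Pi.add_apply, Pi.smul_apply, smul_eq_mul]
    linear_combination (-2 * Real.pi * y * polyGauss P y) * I_sq
  have hint : Integrable (fun y : ℝ => y • polyGauss P y) := by
    simpa [hX] using integrable_polyGauss (X * P)
  have hint' : Integrable (fun y : ℝ => (-2 * Real.pi * I * y) • polyGauss P y) := by
    refine (hint.const_mul (-2 * Real.pi * I)).congr (ae_of_all _ fun y => ?_)
    simp [mul_assoc]
  have hintd : Integrable (deriv (polyGauss P)) := hd ▸ integrable_polyGauss _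
  have h1 := congrFun (Real.fourier_deriv (integrable_polyGauss P)
    (fun y => (hasDerivAt_polyGauss P y).differentiableAt) hintd) x
  have h2 := congrFun (Real.deriv_fourier (integrable_polyGauss P) hint) x
  have h3 : deriv (𝓕 (polyGauss P)) x = c * deriv (polyGauss P) x := by
    rw [funext h]
    exact deriv_const_mul _ (hasDerivAt_polyGauss P x).differentiableAt
  have hadd : 𝓕 (deriv (polyGauss P) + (-I) • fun y : ℝ => (-2 * Real.pi * I * y) • polyGauss P y) x
      = 𝓕 (deriv (polyGauss P)) x
        + (-I) * 𝓕 (fun y : ℝ => (-2 * Real.pi * I * y) • polyGauss P y) x := by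
    rw [← fourier_const_mul]
    exact congrFun (VectorFourier.fourierIntegral_add (L := innerₗ ℝ) Real.continuous_fourierChar
      continuous_inner hintd (hint'.smul (-I))) x
  rw [hsplit', hadd, h1, ← h2, h3, ← hsplit', hsplit, smul_eq_mul, h]
  ring

/-- The polynomial `Q_n` with `(d/dx)^n e^{-2πx²} = Q_n(x) e^{-2πx²}`. -/
noncomputable def hermitePoly : ℕ → ℝ[X]
  | 0 => 1
  | n + 1 => derivative (hermitePoly n) - C (4 * Real.pi) * X * hermitePoly n

lemma iteratedDeriv_exp_neg_two_pi_sq (n : ℕ) :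
    iteratedDeriv n (fun t : ℝ => Real.exp (-2 * Real.pi * t ^ 2)) =
      fun x => (hermitePoly n).eval x * Real.exp (-2 * Real.pi * x ^ 2) := by
  induction n with
  | zero => ext x; simp [hermitePoly]
  | succ n ih =>
    ext x
    rw [iteratedDeriv_succ, ih]
    have h : HasDerivAt
        (fun y : ℝ => (hermitePoly n).eval y * Real.exp (-2 * Real.pi * y ^ 2)) _ x :=
      ((hermitePoly n).hasDerivAt x).mul
        (((hasDerivAt_pow 2 x).const_mul (-2 * Real.pi)).exp)
    rw [h.deriv]
    simp only [hermitePoly, eval_sub, eval_mul, eval_C, eval_X]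
    push_cast
    ring

lemma fourier_polyGauss_hermitePoly (n : ℕ) (x : ℝ) :
    𝓕 (polyGauss (hermitePoly n)) x = (-I) ^ n * polyGauss (hermitePoly n) x := by
  induction n generalizing x with
  | zero => simp [hermitePoly, fourier_polyGauss_one]
  | succ n ih => rw [hermitePoly, fourier_polyGauss_step ih, pow_succ']

lemma hermiteFun_eq_polyGauss (n : ℕ) :
    ∃ c : ℝ, ∀ x, (hermiteFun n x : ℂ) = c * polyGauss (hermitePoly n) x := by
  refine ⟨((2 * Real.pi) ^ n * (2 : ℝ) ^ ((n : ℝ) - 1 / 2) * (n.factorial : ℝ)) ^ (-(1 / 2 : ℝ)),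
    fun x => ?_⟩
  have h : Real.exp (-Real.pi * x ^ 2) =
      Real.exp (Real.pi * x ^ 2) * Real.exp (-2 * Real.pi * x ^ 2) := by
    rw [← Real.exp_add]
    congr 1
    ring
  rw [hermiteFun, iteratedDeriv_exp_neg_two_pi_sq, polyGauss, ← Complex.ofReal_mul, h]
  congr 1
  ring

lemma hermiteFun_neg (n : ℕ) (x : ℝ) : hermiteFun n (-x) = (-1) ^ n * hermiteFun n x := by
  have h := iteratedDeriv_comp_neg n (fun t : ℝ => Real.exp (-2 * Real.pi * t ^ 2)) (-x)
  simp only [neg_sq, neg_neg, smul_eq_mul] at h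
  rw [hermiteFun, h, hermiteFun, neg_sq]
  ring

lemma fourier_comp_mul_left (f : ℝ → ℂ) {a : ℝ} (ha : 0 < a) (w : ℝ) :
    𝓕 (fun x => f (a * x)) w = (a : ℂ)⁻¹ * 𝓕 f (w / a) := by
  rw [Real.fourier_real_eq, Real.fourier_real_eq]
  have h := Measure.integral_comp_mul_left (fun y : ℝ => Real.fourierChar (-(y * (w / a))) • f y) a
  rw [abs_of_pos (inv_pos.2 ha), Complex.real_smul, Complex.ofReal_inv] at h
  rw [← h]
  congr 1
  ext v
  congr 3
  field_simp

lemma isBigO_comp_mul_left {f : ℝ → ℂ} {b : ℝ} (hf : f =O[cocompact ℝ] fun x : ℝ => |x| ^ b)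
    {a : ℝ} (ha : 0 < a) :
    (fun x => f (a * x)) =O[cocompact ℝ] fun x : ℝ => |x| ^ b := by
  have ht : Tendsto (fun x : ℝ => a * x) (cocompact ℝ) (cocompact ℝ) :=
    (Homeomorph.mulLeft₀ a ha.ne').isClosedEmbedding.tendsto_cocompact
  refine (hf.comp_tendsto ht).trans (IsBigO.of_bound |a ^ b| (Eventually.of_forall fun x => ?_))
  simp only [Function.comp_apply, abs_mul, Real.norm_eq_abs, abs_of_pos ha,
    Real.mul_rpow ha.le (abs_nonneg x), le_refl]

/-- The samples along `√s ℤ + p / √s` of an eigenfunction of the Fourier transform, summed for each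
residue `p` modulo `s`, form an eigenvector of the discrete Fourier transform. -/
lemma sqrt_mul_tsum_eq_sum_fin {f : ℝ → ℂ} {c : ℂ} (hc : Continuous f)
    (hO : f =O[cocompact ℝ] fun x : ℝ => |x| ^ (-2 : ℝ)) (hF : ∀ x, 𝓕 f x = c * f x)
    (s : ℕ) [NeZero s] (p : ℕ) :
    (√(s : ℝ) : ℂ) * ∑' k : ℤ, f (√(s : ℝ) * (k + (p : ℝ) / s)) =
      c * ∑ q : Fin s, Complex.exp (2 * Real.pi * I * (p * (q : ℕ) / s)) *
        ∑' k : ℤ, f (√(s : ℝ) * (k + ((q : ℕ) : ℝ) / s)) := by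
  have hs : (0 : ℝ) < s := Nat.cast_pos.2 (NeZero.pos s)
  have hs' : (s : ℂ) ≠ 0 := NeZero.ne _
  have hr : 0 < √(s : ℝ) := Real.sqrt_pos.2 hs
  have hr' : (√(s : ℝ) : ℂ) ≠ 0 := Complex.ofReal_ne_zero.2 hr.ne'
  have hFg : ∀ w, 𝓕 (fun x => f (√(s : ℝ) * x)) w =
      (√(s : ℝ) : ℂ)⁻¹ * (c * f ((√(s : ℝ))⁻¹ * w)) := fun w => by
    rw [fourier_comp_mul_left f hr, hF, div_eq_inv_mul]
  have hFO : 𝓕 (fun x => f (√(s : ℝ) * x)) =O[cocompact ℝ] fun x : ℝ => |x| ^ (-2 : ℝ) := by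
    rw [funext hFg]
    exact ((isBigO_comp_mul_left hO (inv_pos.2 hr)).const_mul_left c).const_mul_left _
  have hP := Real.tsum_eq_tsum_fourier_of_rpow_decay (f := fun x => f (√(s : ℝ) * x))
    (by fun_prop) one_lt_two (isBigO_comp_mul_left hO hr) hFO ((p : ℝ) / s)
  have hsum : Summable fun n : ℤ => 𝓕 (fun x => f (√(s : ℝ) * x)) n *
      fourier n (((p : ℝ) / s : ℝ) : UnitAddCircle) := by
    have h := summable_of_isBigO (Real.summable_abs_int_rpow one_lt_two)
      (hFO.comp_tendsto Int.tendsto_coe_cofinite)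
    refine Summable.of_norm (h.norm.congr fun n => ?_)
    rw [norm_mul, fourier_apply, Circle.norm_coe, mul_one]
    rfl
  let e : Fin s × ℤ ≃ ℤ := (Equiv.prodComm _ _).trans (Int.divModEquiv s).symm
  replace hP := hP.trans ((e.tsum_eq _).symm.trans (e.summable_iff.2 hsum).tsum_prod)
  have hterm : ∀ (q : Fin s) (k : ℤ), 𝓕 (fun x => f (√(s : ℝ) * x)) (e (q, k)) *
      fourier (e (q, k)) (((p : ℝ) / s : ℝ) : UnitAddCircle) =
      (√(s : ℝ) : ℂ)⁻¹ * c * Complex.exp (2 * Real.pi * I * (p * (q : ℕ) / s)) *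
        f (√(s : ℝ) * (k + ((q : ℕ) : ℝ) / s)) := fun q k => by
    have he : e (q, k) = k * s + (q : ℕ) := by simp [e]
    have h1 : (√(s : ℝ))⁻¹ * ((e (q, k) : ℤ) : ℝ) = √(s : ℝ) * (k + ((q : ℕ) : ℝ) / s) := by
      rw [he]
      push_cast
      field_simp
      rw [Real.sq_sqrt hs.le]
    have h2 : 2 * Real.pi * I * ((e (q, k) : ℤ) : ℂ) * (((p : ℝ) / s : ℝ) : ℂ) / ((1 : ℝ) : ℂ) =
        2 * Real.pi * I * (p * (q : ℕ) / s) + ((k * p : ℤ) : ℂ) * (2 * Real.pi * I) := by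
      rw [he]
      push_cast
      field_simp
      ring
    rw [hFg, fourier_coe_apply, h2, Complex.exp_periodic.int_mul, h1]
    ring
  have hP' : ∑' k : ℤ, f (√(s : ℝ) * (k + (p : ℝ) / s)) = (√(s : ℝ) : ℂ)⁻¹ * c *
      ∑ q : Fin s, Complex.exp (2 * Real.pi * I * (p * (q : ℕ) / s)) *
        ∑' k : ℤ, f (√(s : ℝ) * (k + ((q : ℕ) : ℝ) / s)) := by
    rw [Finset.mul_sum]
    simp_rw [add_comm _ ((p : ℝ) / s)]
    rw [hP, tsum_fintype]
    refine Finset.sum_congr rfl fun q _ => ?_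
    simp only [Function.comp_apply, hterm, tsum_mul_left]
    simp_rw [add_comm _ (((q : ℕ) : ℝ) / s)]
    ring
  rw [hP', mul_assoc, mul_inv_cancel_left₀ hr']

lemma tsum_eq_neg_tsum_of_odd {f : ℝ → ℂ} (hodd : ∀ x, f (-x) = -f x) (s : ℕ) [NeZero s] {p q : ℕ}
    (hpq : s ∣ p + q) :
    ∑' k : ℤ, f (√(s : ℝ) * (k + (p : ℝ) / s)) = -∑' k : ℤ, f (√(s : ℝ) * (k + (q : ℝ) / s)) := by
  obtain ⟨d, hd⟩ := hpq
  have hs : (s : ℝ) ≠ 0 := NeZero.ne _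
  have hd' : (p : ℝ) + q = s * d := mod_cast hd
  rw [← tsum_neg, ← (Equiv.subLeft (-(d : ℤ))).tsum_eq]
  congr 1
  ext k
  rw [← hodd]
  congr 1
  simp only [Equiv.subLeft_apply]
  push_cast
  field_simp
  linear_combination hd'

lemma tsum_eq_zero_of_odd_of_fourier_eq {f : ℝ → ℂ} (hodd : ∀ x, f (-x) = -f x) (hc : Continuous f)
    (hO : f =O[cocompact ℝ] fun x : ℝ => |x| ^ (-2 : ℝ)) (hF : ∀ x, 𝓕 f x = I * f x)
    {s : ℕ} (hs : s ∈ ({2, 3, 4} : Set ℕ)) {p : ℕ} (hp : p < s) :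
    ∑' k : ℤ, f (√(s : ℝ) * (k + (p : ℝ) / s)) = 0 := by
  have hself : ∀ (t : ℕ) [NeZero t] (q : ℕ), t ∣ q + q →
      ∑' k : ℤ, f (√(t : ℝ) * (k + (q : ℝ) / t)) = 0 := fun t _ q h =>
    self_eq_neg.1 (tsum_eq_neg_tsum_of_odd hodd t h)
  rcases hs with rfl | rfl | rfl
  · interval_cases p
    · exact hself 2 0 (by norm_num)
    · exact hself 2 1 (by norm_num)
  · have h0 := hself 3 0 (by norm_num)
    have h2 := tsum_eq_neg_tsum_of_odd hodd 3 (p := 2) (q := 1) (by norm_num)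
    have h1 : ∑' k : ℤ, f (√((3 : ℕ) : ℝ) * (k + ((1 : ℕ) : ℝ) / (3 : ℕ))) = 0 := by
      have h := sqrt_mul_tsum_eq_sum_fin hc hO hF 3 1
      have e1 : Complex.exp (2 * Real.pi * I * ((1 : ℕ) * (1 : ℕ) / (3 : ℕ))) =
          -1 / 2 + √(3 : ℝ) / 2 * I := by
        rw [show (2 * Real.pi * I * ((1 : ℕ) * (1 : ℕ) / (3 : ℕ)) : ℂ) =
            ((Real.pi - Real.pi / 3 : ℝ) : ℂ) * I by push_cast; ring,
          Complex.exp_mul_I, ← Complex.ofReal_cos, ← Complex.ofReal_sin, Real.cos_pi_sub,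
          Real.sin_pi_sub, Real.cos_pi_div_three, Real.sin_pi_div_three]
        push_cast
        ring
      have e2 : Complex.exp (2 * Real.pi * I * ((1 : ℕ) * (2 : ℕ) / (3 : ℕ))) =
          -1 / 2 - √(3 : ℝ) / 2 * I := by
        rw [show (2 * Real.pi * I * ((1 : ℕ) * (2 : ℕ) / (3 : ℕ)) : ℂ) =
            ((Real.pi / 3 + Real.pi : ℝ) : ℂ) * I by push_cast; ring,
          Complex.exp_mul_I, ← Complex.ofReal_cos, ← Complex.ofReal_sin, Real.cos_add_pi,
          Real.sin_add_pi, Real.cos_pi_div_three, Real.sin_pi_div_three]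
        push_cast
        ring
      rw [Fin.sum_univ_three] at h
      simp only [Fin.val_zero, Fin.val_one, Fin.val_two] at h
      rw [h0, h2, e1, e2] at h
      generalize (∑' k : ℤ, f (√((3 : ℕ) : ℝ) * (k + ((1 : ℕ) : ℝ) / (3 : ℕ)))) = F at h ⊢
      have h3 : (√(3 : ℝ) : ℂ) ≠ 0 := by simp
      refine (mul_eq_zero.1 (?_ : (√(3 : ℝ) : ℂ) * F = 0)).resolve_left h3
      push_cast at h
      linear_combination h / 2 + (√(3 : ℝ) : ℂ) * F / 2 * I_sq
    interval_cases p
    · exact h0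
    · exact h1
    · rw [h2, h1, neg_zero]
  · have h0 := hself 4 0 (by norm_num)
    have h2 := hself 4 2 (by norm_num)
    have h3 := tsum_eq_neg_tsum_of_odd hodd 4 (p := 3) (q := 1) (by norm_num)
    have h1 : ∑' k : ℤ, f (√((4 : ℕ) : ℝ) * (k + ((1 : ℕ) : ℝ) / (4 : ℕ))) = 0 := by
      have h := sqrt_mul_tsum_eq_sum_fin hc hO hF 4 1
      have e1 : Complex.exp (2 * Real.pi * I * ((1 : ℕ) * (1 : ℕ) / (4 : ℕ))) = I := by
        refine Eq.trans ?_ Complex.exp_pi_div_two_mul_I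
        congr 1
        push_cast
        ring
      have e3 : Complex.exp (2 * Real.pi * I * ((1 : ℕ) * (3 : ℕ) / (4 : ℕ))) = -I := by
        refine Eq.trans ?_ ((Complex.exp_periodic _).trans Complex.exp_neg_pi_div_two_mul_I)
        congr 1
        push_cast
        ring
      have hr : √((4 : ℕ) : ℝ) = 2 := by
        rw [show ((4 : ℕ) : ℝ) = 2 ^ 2 by norm_num]
        exact Real.sqrt_sq two_pos.le
      rw [Fin.sum_univ_four] at h
      simp only [Fin.val_zero, Fin.val_one, Fin.val_two, show ((3 : Fin 4) : ℕ) = 3 from rfl] at h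
      rw [h0, h2, h3, e1, e3] at h
      generalize (∑' k : ℤ, f (√((4 : ℕ) : ℝ) * (k + ((1 : ℕ) : ℝ) / (4 : ℕ)))) = F at h ⊢
      rw [hr] at h
      push_cast at h
      linear_combination h / 4 + F / 2 * I_sq
    interval_cases p
    · exact h0
    · exact h1
    · exact h2
    · rw [h3, h1, neg_zero]

theorem hermite_4m3_sum (m : ℕ) :
    ∀ s ∈ ({2, 3, 4} : Set ℕ), ∀ p < s,
      ∑' k : ℤ, hermiteFun (4 * m + 3) (Real.sqrt s * ((k : ℝ) + (p : ℝ) / s)) = 0 := by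
  intro s hs p hp
  obtain ⟨c, hf⟩ := hermiteFun_eq_polyGauss (4 * m + 3)
  have hf' : (fun x => (hermiteFun (4 * m + 3) x : ℂ)) =
      fun x => c * polyGauss (hermitePoly (4 * m + 3)) x := funext hf
  have hodd : ∀ x, (hermiteFun (4 * m + 3) (-x) : ℂ) = -hermiteFun (4 * m + 3) x := fun x => by
    rw [hermiteFun_neg, Odd.neg_one_pow ⟨2 * m + 1, by ring⟩]
    simp
  have hI : (-I) ^ (4 * m + 3) = I := by
    rw [pow_add, pow_mul, show (-I) ^ 4 = 1 by rw [Even.neg_pow (by decide), I_pow_four],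
      one_pow, one_mul, Odd.neg_pow (by decide), I_pow_three, neg_neg]
  have hF : ∀ x, 𝓕 (fun x => (hermiteFun (4 * m + 3) x : ℂ)) x =
      I * (hermiteFun (4 * m + 3) x : ℂ) := fun x => by
    rw [hf', fourier_const_mul, fourier_polyGauss_hermitePoly, hI, hf]
    ring
  have h := tsum_eq_zero_of_odd_of_fourier_eq hodd
    (hf' ▸ (continuous_polyGauss _).const_mul _)
    (hf' ▸ (polyGauss_isBigO _ _).const_mul_left _) hF hs hp
  exact_mod_cast h
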